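/- arXiv:0809.5024 — 3 statements merged into one kernel-verified Lean document; each statement's English description precedes it below -/
import Mathlib

section
/- Let Σ ∈ ℂ^{n×n} be Hermitian and positive definite. The following are equivalent: (i) there exists H ∈ ℂ^{m×n} such that Σ − AΣA* = BH + H*B*; (ii) there exists a bounded, coercive, Hermitian positive-definite m×m-matrix-valued (essentially bounded measurable) function Φ on the unit circle 𝕋 such that ∫ G Φ G* = Σ; (iii) there exists a continuous Hermitian-matrix-valued function Φ on 𝕋 with Φ(e^{jθ}) ≻ 0 for all θ such that Γ(Φ) = Σ. -/
open Matrix MeasureTheory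
open scoped ComplexOrder

/-- Entrywise integral over the unit circle, `∫_{-π}^{π} F(e^{jθ}) dθ/2π`. -/
noncomputable def circleIntM {n m : ℕ} (F : ℝ → Matrix (Fin n) (Fin m) ℂ) :
    Matrix (Fin n) (Fin m) ℂ :=
  Matrix.of fun i j => (2 * (Real.pi : ℂ))⁻¹ * ∫ θ in (-Real.pi)..Real.pi, F θ i j

/-- The transfer function `G(z) = (zI - A)⁻¹ B` evaluated at `z = e^{jθ}`. -/
noncomputable def Gfun {n m : ℕ} (A : Matrix (Fin n) (Fin n) ℂ)
    (B : Matrix (Fin n) (Fin m) ℂ) (θ : ℝ) : Matrix (Fin n) (Fin m) ℂ :=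
  (Complex.exp (θ * Complex.I) • (1 : Matrix (Fin n) (Fin n) ℂ) - A)⁻¹ * B

/-- The pair `(A, B)` is reachable: the controllability matrix
`[B, AB, ..., A^{n-1}B]` has rank `n`. -/
noncomputable def IsReachable {n m : ℕ} (A : Matrix (Fin n) (Fin n) ℂ)
    (B : Matrix (Fin n) (Fin m) ℂ) : Prop :=
  (Matrix.of fun (i : Fin n) (p : Fin n × Fin m) => (A ^ (p.1 : ℕ) * B) i p.2).rank = n


/-- Entrywise integrability over one period. -/
def CircleIntegrableM {n m : ℕ} (F : ℝ → Matrix (Fin n) (Fin m) ℂ) : Prop :=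
  ∀ i j, IntervalIntegrable (fun θ => F θ i j) volume (-Real.pi) Real.pi

section CircleInt

variable {n m k : ℕ}

theorem Continuous.circleIntegrableM {F : ℝ → Matrix (Fin n) (Fin m) ℂ} (hF : Continuous F) :
    CircleIntegrableM F :=
  fun i j => (hF.matrix_elem i j).intervalIntegrable _ _

theorem CircleIntegrableM.add {F G : ℝ → Matrix (Fin n) (Fin m) ℂ}
    (hF : CircleIntegrableM F) (hG : CircleIntegrableM G) :
    CircleIntegrableM fun θ => F θ + G θ :=
  fun i j => (hF i j).add (hG i j)

theorem CircleIntegrableM.continuous_mul {C : ℝ → Matrix (Fin k) (Fin n) ℂ} (hC : Continuous C)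
    {F : ℝ → Matrix (Fin n) (Fin m) ℂ} (hF : CircleIntegrableM F) :
    CircleIntegrableM fun θ => C θ * F θ := by
  intro i j
  simp only [Matrix.mul_apply]
  have h := IntervalIntegrable.sum Finset.univ fun l _ =>
    (hF l j).continuousOn_mul (hC.matrix_elem i l).continuousOn
  rwa [Finset.sum_fn] at h

theorem CircleIntegrableM.mul_continuous {C : ℝ → Matrix (Fin m) (Fin k) ℂ} (hC : Continuous C)
    {F : ℝ → Matrix (Fin n) (Fin m) ℂ} (hF : CircleIntegrableM F) :
    CircleIntegrableM fun θ => F θ * C θ := by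
  intro i j
  simp only [Matrix.mul_apply]
  have h := IntervalIntegrable.sum Finset.univ fun l _ =>
    (hF i l).mul_continuousOn (hC.matrix_elem l j).continuousOn
  rwa [Finset.sum_fn] at h

theorem circleIntM_add {F G : ℝ → Matrix (Fin n) (Fin m) ℂ}
    (hF : CircleIntegrableM F) (hG : CircleIntegrableM G) :
    circleIntM (fun θ => F θ + G θ) = circleIntM F + circleIntM G := by
  ext i j
  simp only [circleIntM, Matrix.of_apply, Matrix.add_apply]
  rw [intervalIntegral.integral_add (hF i j) (hG i j), mul_add]

theorem circleIntM_const_mul (C : Matrix (Fin k) (Fin n) ℂ) {F : ℝ → Matrix (Fin n) (Fin m) ℂ}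
    (hF : CircleIntegrableM F) :
    circleIntM (fun θ => C * F θ) = C * circleIntM F := by
  ext i j
  simp only [circleIntM, Matrix.of_apply, Matrix.mul_apply]
  rw [intervalIntegral.integral_finsetSum fun l _ => (hF l j).const_mul _, Finset.mul_sum]
  refine Finset.sum_congr rfl fun l _ => ?_
  rw [intervalIntegral.integral_const_mul]
  ring

theorem circleIntM_conjTranspose (F : ℝ → Matrix (Fin n) (Fin m) ℂ) :
    circleIntM (fun θ => (F θ)ᴴ) = (circleIntM F)ᴴ := by
  ext i j
  simp only [circleIntM, Matrix.of_apply, Matrix.conjTranspose_apply, star_mul']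
  congr 1
  · simp
  · exact intervalIntegral.intervalIntegral_conj

theorem CircleIntegrableM.conjTranspose {F : ℝ → Matrix (Fin n) (Fin m) ℂ}
    (hF : CircleIntegrableM F) : CircleIntegrableM fun θ => (F θ)ᴴ := by
  intro i j
  have := hF j i
  rw [intervalIntegrable_iff] at this ⊢
  exact (LinearIsometryEquiv.integrable_comp_iff Complex.conjLIE).2 this

theorem circleIntM_mul_const (C : Matrix (Fin m) (Fin k) ℂ) {F : ℝ → Matrix (Fin n) (Fin m) ℂ}
    (hF : CircleIntegrableM F) :
    circleIntM (fun θ => F θ * C) = circleIntM F * C := by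
  have h := circleIntM_const_mul Cᴴ hF.conjTranspose
  rw [circleIntM_conjTranspose, ← Matrix.conjTranspose_mul] at h
  simp only [← Matrix.conjTranspose_mul] at h
  rw [circleIntM_conjTranspose] at h
  exact Matrix.conjTranspose_injective h

theorem circleIntM_const (C : Matrix (Fin n) (Fin m) ℂ) : circleIntM (fun _ => C) = C := by
  ext i j
  simp only [circleIntM, Matrix.of_apply, intervalIntegral.integral_const, Complex.real_smul]
  have : (Real.pi : ℂ) ≠ 0 := by exact_mod_cast Real.pi_ne_zero
  push_cast
  field_simp
  ring

end CircleInt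

section Resolvent

variable {n m : ℕ} {F : Matrix (Fin n) (Fin n) ℂ}

theorem isUnit_one_sub_smul (hF : ∀ z ∈ spectrum ℂ F, ‖z‖ < 1) {w : ℂ} (hw : ‖w‖ ≤ 1) :
    IsUnit (1 - w • F).det := by
  rcases eq_or_ne w 0 with rfl | hw0
  · simp
  · have h : w⁻¹ ∉ spectrum ℂ F := fun h => by
      have := hF _ h
      rw [norm_inv, inv_lt_one₀ (norm_pos_iff.2 hw0)] at this
      linarith
    rw [spectrum.notMem_iff, Algebra.algebraMap_eq_smul_one, Matrix.isUnit_iff_isUnit_det] at h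
    have hw1 : 1 - w • F = w • (w⁻¹ • 1 - F) := by
      rw [smul_sub, smul_smul, mul_inv_cancel₀ hw0, one_smul]
    rw [hw1, Matrix.det_smul]
    exact ((IsUnit.mk0 w hw0).pow _).mul h

theorem isUnit_smul_one_sub (hF : ∀ z ∈ spectrum ℂ F, ‖z‖ < 1) {z : ℂ} (hz : ‖z‖ = 1) :
    IsUnit (z • (1 : Matrix (Fin n) (Fin n) ℂ) - F).det := by
  rw [← Matrix.isUnit_iff_isUnit_det, ← Algebra.algebraMap_eq_smul_one, ← spectrum.notMem_iff]
  exact fun h => (hF z h).ne hz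

theorem norm_exp_mul_I (θ : ℝ) : ‖Complex.exp (θ * Complex.I)‖ = 1 :=
  Complex.norm_exp_ofReal_mul_I θ

theorem continuous_resolvent (hF : ∀ z ∈ spectrum ℂ F, ‖z‖ < 1) :
    Continuous fun θ : ℝ =>
      (Complex.exp (θ * Complex.I) • (1 : Matrix (Fin n) (Fin n) ℂ) - F)⁻¹ := by
  have hc : Continuous fun θ : ℝ =>
      Complex.exp (θ * Complex.I) • (1 : Matrix (Fin n) (Fin n) ℂ) - F := by fun_prop
  simp only [Matrix.inv_def, Ring.inverse_eq_inv']
  exact (hc.matrix_det.inv₀ fun θ =>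
    (isUnit_smul_one_sub hF (norm_exp_mul_I θ)).ne_zero).smul hc.matrix_adjugate

theorem Matrix.differentiable_det {M : ℂ → Matrix (Fin n) (Fin n) ℂ}
    (hM : ∀ i j, Differentiable ℂ fun w => M w i j) : Differentiable ℂ fun w => (M w).det := by
  simp only [Matrix.det_apply']
  fun_prop

theorem Matrix.differentiable_adjugate {M : ℂ → Matrix (Fin n) (Fin n) ℂ}
    (hM : ∀ i j, Differentiable ℂ fun w => M w i j) (i j : Fin n) :
    Differentiable ℂ fun w => (M w).adjugate i j := by
  simp only [Matrix.adjugate_apply]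
  refine Matrix.differentiable_det fun k l => ?_
  by_cases h : k = j
  · subst h
    simp
  · simpa [Matrix.updateRow_ne h] using hM k l

/-- The mean over the circle of `z (zI - F)⁻¹ = (I - z⁻¹F)⁻¹` is its value at infinity. -/
theorem circleIntM_resolvent (hF : ∀ z ∈ spectrum ℂ F, ‖z‖ < 1) :
    circleIntM (fun θ : ℝ => Complex.exp (θ * Complex.I) •
      (Complex.exp (θ * Complex.I) • (1 : Matrix (Fin n) (Fin n) ℂ) - F)⁻¹) = 1 := by
  have hR : ∀ θ : ℝ, Complex.exp (θ * Complex.I) •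
      (Complex.exp (θ * Complex.I) • (1 : Matrix (Fin n) (Fin n) ℂ) - F)⁻¹ =
      (1 - circleMap 0 1 (-θ) • F)⁻¹ := by
    intro θ
    have hu := isUnit_smul_one_sub hF (norm_exp_mul_I θ)
    have hz : circleMap 0 1 (-θ) = (Complex.exp (θ * Complex.I))⁻¹ := by
      simp [circleMap, Complex.exp_neg]
    rw [hz]
    have hz0 := Complex.exp_ne_zero (θ * Complex.I)
    generalize Complex.exp (θ * Complex.I) = z at hu hz0
    refine (Matrix.inv_eq_right_inv ?_).symm
    have hs : (1 - z⁻¹ • F) = z⁻¹ • (z • 1 - F) := by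
      rw [smul_sub, smul_smul, inv_mul_cancel₀ hz0, one_smul]
    rw [hs, Matrix.smul_mul, Matrix.mul_smul, smul_smul, inv_mul_cancel₀ hz0, one_smul,
      Matrix.mul_nonsing_inv _ hu]
  simp only [hR]
  ext i j
  have hd : Differentiable ℂ fun w : ℂ => (1 - w • F).det :=
    Matrix.differentiable_det fun k l => by
      simp only [Matrix.sub_apply, Matrix.smul_apply]; fun_prop
  have ha : Differentiable ℂ fun w : ℂ => (1 - w • F).adjugate i j :=
    Matrix.differentiable_adjugate (fun k l => by
      simp only [Matrix.sub_apply, Matrix.smul_apply]; fun_prop) i j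
  have hdiff : DifferentiableOn ℂ (fun w : ℂ => (1 - w • F)⁻¹ i j) (Metric.closedBall 0 1) := by
    simp only [Matrix.inv_def, Ring.inverse_eq_inv', Matrix.smul_apply, smul_eq_mul]
    exact (hd.differentiableOn.fun_inv fun w hw =>
      (isUnit_one_sub_smul hF (by simpa using hw)).ne_zero).fun_mul ha.differentiableOn
  have havg : Real.circleAverage (fun w : ℂ => (1 - w • F)⁻¹ i j) 0 1 =
      (1 : Matrix (Fin n) (Fin n) ℂ) i j := by
    rw [DiffContOnCl.circleAverage]
    · simp
    · refine DifferentiableOn.diffContOnCl ?_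
      rw [closure_ball _ (by simp)]
      simpa using hdiff
  rw [← havg, Real.circleAverage_def]
  simp only [circleIntM, Matrix.of_apply]
  rw [intervalIntegral.integral_comp_neg fun θ => (1 - circleMap 0 1 θ • F)⁻¹ i j, neg_neg,
    Complex.real_smul]
  have hp : Function.Periodic (fun θ => (1 - circleMap 0 1 θ • F)⁻¹ i j) (2 * Real.pi) :=
    (periodic_circleMap 0 1).comp fun w => (1 - w • F)⁻¹ i j
  have := hp.intervalIntegral_add_eq (-Real.pi) 0
  rw [zero_add, show -Real.pi + 2 * Real.pi = Real.pi by ring] at this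
  rw [this]
  push_cast
  rfl

/-- A stable resolvent integrates its own Stein equation. -/
theorem circleIntM_resolvent_mul_mul (hF : ∀ z ∈ spectrum ℂ F, ‖z‖ < 1)
    {S : Matrix (Fin n) (Fin n) ℂ} (hS : S.IsHermitian) :
    circleIntM (fun θ : ℝ =>
      (Complex.exp (θ * Complex.I) • (1 : Matrix (Fin n) (Fin n) ℂ) - F)⁻¹ * (S - F * S * Fᴴ) *
        (Complex.exp (θ * Complex.I) • (1 : Matrix (Fin n) (Fin n) ℂ) - F)⁻¹ᴴ) = S := by
  set T : ℝ → Matrix (Fin n) (Fin n) ℂ := fun θ => Complex.exp (θ * Complex.I) •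
    (Complex.exp (θ * Complex.I) • (1 : Matrix (Fin n) (Fin n) ℂ) - F)⁻¹ with hT
  have hTc : Continuous T :=
    (show Continuous fun θ : ℝ => Complex.exp (θ * Complex.I) by fun_prop).smul
      (continuous_resolvent hF)
  have key : ∀ θ : ℝ,
      (Complex.exp (θ * Complex.I) • (1 : Matrix (Fin n) (Fin n) ℂ) - F)⁻¹ * (S - F * S * Fᴴ) *
        (Complex.exp (θ * Complex.I) • (1 : Matrix (Fin n) (Fin n) ℂ) - F)⁻¹ᴴ =
      (T θ * S + (T θ * S)ᴴ) + -S := by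
    intro θ
    have hu := isUnit_smul_one_sub hF (norm_exp_mul_I θ)
    have hz : star (Complex.exp (θ * Complex.I)) * Complex.exp (θ * Complex.I) = 1 := by
      have := Complex.conj_mul' (Complex.exp (θ * Complex.I))
      rwa [norm_exp_mul_I, Complex.ofReal_one, one_pow] at this
    simp only [hT]
    generalize Complex.exp (θ * Complex.I) = z at hu hz
    have hr := Matrix.nonsing_inv_mul _ hu
    generalize (z • (1 : Matrix (Fin n) (Fin n) ℂ) - F)⁻¹ = R at hr
    have hRF : R * F = z • R - 1 := by
      rw [Matrix.mul_sub, Matrix.mul_smul, Matrix.mul_one] at hr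
      rw [← hr]; abel
    have hRF' : Fᴴ * Rᴴ = star z • Rᴴ - 1 := by
      rw [← Matrix.conjTranspose_mul, hRF]; simp
    calc R * (S - F * S * Fᴴ) * Rᴴ = R * S * Rᴴ - (R * F) * S * (Fᴴ * Rᴴ) := by
          simp only [Matrix.mul_sub, Matrix.sub_mul, Matrix.mul_assoc]
      _ = _ := by
          rw [hRF, hRF']
          simp only [Matrix.mul_sub, Matrix.sub_mul, Matrix.mul_smul, Matrix.smul_mul, smul_sub,
            smul_smul, Matrix.conjTranspose_mul, Matrix.conjTranspose_smul, hS.eq, Matrix.mul_one,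
            Matrix.one_mul, hz, one_smul, Matrix.mul_assoc]
          abel
  have hTS : CircleIntegrableM fun θ => T θ * S :=
    (hTc.matrix_mul continuous_const).circleIntegrableM
  have h1 : circleIntM T = 1 := circleIntM_resolvent hF
  simp only [key]
  rw [circleIntM_add (hTS.add hTS.conjTranspose) continuous_const.circleIntegrableM,
    circleIntM_add hTS hTS.conjTranspose, circleIntM_conjTranspose,
    circleIntM_mul_const S hTc.circleIntegrableM, h1, circleIntM_const, Matrix.one_mul, hS.eq]
  abel

end Resolvent

section Feedback

variable {n m : ℕ}

theorem mem_spectrum_iff_exists_conjTranspose_mulVec {F : Matrix (Fin n) (Fin n) ℂ} {z : ℂ} :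
    z ∈ spectrum ℂ F ↔ ∃ x ≠ 0, Fᴴ *ᵥ x = star z • x := by
  rw [spectrum.mem_iff, Algebra.algebraMap_eq_smul_one, Matrix.isUnit_iff_isUnit_det,
    isUnit_iff_ne_zero, not_not, ← star_eq_zero, ← Matrix.det_conjTranspose,
    ← Matrix.exists_mulVec_eq_zero_iff]
  refine exists_congr fun x => and_congr_right fun _ => ?_
  simp only [Matrix.conjTranspose_sub, Matrix.conjTranspose_smul, Matrix.conjTranspose_one,
    Matrix.sub_mulVec, Matrix.smul_mulVec, Matrix.one_mulVec, sub_eq_zero]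
  exact eq_comm

/-- Feedback preserves stability when a positive definite Stein solution exists. -/
theorem spectrum_feedback_lt_one {A F S : Matrix (Fin n) (Fin n) ℂ} {B : Matrix (Fin n) (Fin m) ℂ}
    {K : Matrix (Fin m) (Fin n) ℂ} {W : Matrix (Fin m) (Fin m) ℂ}
    (hA : ∀ z ∈ spectrum ℂ A, ‖z‖ < 1) (hF : F = A - B * K) (hS : S.PosDef) (hW : W.PosDef)
    (hStein : S - F * S * Fᴴ = B * W * Bᴴ) :
    ∀ z ∈ spectrum ℂ F, ‖z‖ < 1 := by
  intro z hz
  by_contra! hz1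
  obtain ⟨x, hx, hFx⟩ := mem_spectrum_iff_exists_conjTranspose_mulVec.1 hz
  have hq := hS.dotProduct_mulVec_pos hx
  have hFS : star x ⬝ᵥ ((F * S * Fᴴ) *ᵥ x) = (z * star z) * (star x ⬝ᵥ (S *ᵥ x)) := by
    have h : star x ᵥ* F = z • star x := by
      have := congrArg star hFx
      simpa [Matrix.star_mulVec] using this
    rw [← Matrix.mulVec_mulVec, ← Matrix.mulVec_mulVec, hFx, Matrix.dotProduct_mulVec, h,
      Matrix.mulVec_smul, smul_dotProduct, dotProduct_smul, smul_eq_mul, smul_eq_mul, mul_assoc]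
  have hBW : star x ⬝ᵥ ((B * W * Bᴴ) *ᵥ x) = star (Bᴴ *ᵥ x) ⬝ᵥ (W *ᵥ (Bᴴ *ᵥ x)) := by
    rw [← Matrix.mulVec_mulVec, ← Matrix.mulVec_mulVec, Matrix.dotProduct_mulVec,
      Matrix.star_mulVec, Matrix.conjTranspose_conjTranspose]
  have hform := congrArg (fun M => (star x ⬝ᵥ (M *ᵥ x)).re) hStein
  simp only [Matrix.sub_mulVec, dotProduct_sub] at hform
  rw [hFS, hBW] at hform
  have hzz : z * star z = ((‖z‖ ^ 2 : ℝ) : ℂ) := by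
    rw [Complex.ofReal_pow]; exact Complex.mul_conj' z
  rw [hzz, Complex.sub_re, Complex.re_ofReal_mul] at hform
  have hq' := (Complex.pos_iff.1 hq).1
  have hBx : Bᴴ *ᵥ x = 0 := by
    by_contra hBx
    have := (Complex.pos_iff.1 (hW.dotProduct_mulVec_pos hBx)).1
    nlinarith [one_le_pow₀ hz1 (n := 2)]
  have hAx : Aᴴ *ᵥ x = star z • x := by
    rw [← hFx, hF, Matrix.conjTranspose_sub, Matrix.sub_mulVec, Matrix.conjTranspose_mul,
      ← Matrix.mulVec_mulVec, hBx, Matrix.mulVec_zero, sub_zero]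
  exact hz1.not_gt (hA z (mem_spectrum_iff_exists_conjTranspose_mulVec.2 ⟨x, hx, hAx⟩))

/-- The projecting feedback turns the range condition into a Stein equation. -/
theorem stein_of_range_condition {A S : Matrix (Fin n) (Fin n) ℂ} {B : Matrix (Fin n) (Fin m) ℂ}
    {H : Matrix (Fin m) (Fin n) ℂ} {W : Matrix (Fin m) (Fin m) ℂ} (hS : S.IsHermitian)
    (hSu : IsUnit S.det) (hW : W.IsHermitian) (hWB : W * (Bᴴ * S⁻¹ * B) = 1)
    (hH : S - A * S * Aᴴ = B * H + Hᴴ * Bᴴ) :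
    S - (A - B * (W * Bᴴ * S⁻¹ * A)) * S * (A - B * (W * Bᴴ * S⁻¹ * A))ᴴ = B * W * Bᴴ := by
  set N := B * W * Bᴴ with hN
  set P := 1 - N * S⁻¹ with hP
  have hNh : Nᴴ = N := by
    simp [hN, hW.eq, Matrix.mul_assoc]
  have hPA : A - B * (W * Bᴴ * S⁻¹ * A) = P * A := by
    simp only [hP, hN, Matrix.sub_mul, Matrix.one_mul, Matrix.mul_assoc]
  have hPB : P * B = 0 := by
    have : N * S⁻¹ * B = B * (W * (Bᴴ * S⁻¹ * B)) := by simp only [hN, Matrix.mul_assoc]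
    rw [hP, Matrix.sub_mul, this, hWB, Matrix.one_mul, Matrix.mul_one, sub_self]
  have hBP : Bᴴ * Pᴴ = 0 := by
    rw [← Matrix.conjTranspose_mul, hPB, Matrix.conjTranspose_zero]
  have hPS : P * S = S - N := by
    rw [hP, Matrix.sub_mul, Matrix.one_mul, Matrix.mul_assoc, Matrix.nonsing_inv_mul _ hSu,
      Matrix.mul_one]
  have hSP : S * Pᴴ = S - N := by
    have := congrArg Matrix.conjTranspose hPS
    rwa [Matrix.conjTranspose_mul, Matrix.conjTranspose_sub S N, hS.eq, hNh] at this
  have hAS : A * S * Aᴴ = S - (B * H + Hᴴ * Bᴴ) := by rw [← hH]; abel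
  rw [hPA, Matrix.conjTranspose_mul]
  calc S - P * A * S * (Aᴴ * Pᴴ) = S - P * (A * S * Aᴴ) * Pᴴ := by
        simp only [Matrix.mul_assoc]
    _ = S - (P * (S * Pᴴ) - (P * B * (H * Pᴴ) + P * (Hᴴ * (Bᴴ * Pᴴ)))) := by
        rw [hAS]
        simp only [Matrix.mul_sub, Matrix.sub_mul, Matrix.mul_add, Matrix.add_mul,
          Matrix.mul_assoc]
    _ = S - P * (S - N) := by
        rw [hPB, hBP, hSP]; simp
    _ = N := by
        rw [Matrix.mul_sub, hPS, hN, ← Matrix.mul_assoc, ← Matrix.mul_assoc, hPB]; simp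

theorem feedback_mul_return_difference {M N : Matrix (Fin n) (Fin n) ℂ}
    {B : Matrix (Fin n) (Fin m) ℂ} {K : Matrix (Fin m) (Fin n) ℂ} (hM : IsUnit M.det)
    (hN : IsUnit N.det) (hMN : N = M + B * K) :
    (1 - K * N⁻¹ * B) * (1 + K * M⁻¹ * B) = 1 := by
  have h : M⁻¹ - N⁻¹ = N⁻¹ * (B * K) * M⁻¹ := by
    rw [← sub_eq_iff_eq_add'.2 hMN, Matrix.mul_sub, Matrix.sub_mul, Matrix.nonsing_inv_mul _ hN,
      Matrix.mul_assoc, Matrix.mul_nonsing_inv _ hM, Matrix.one_mul, Matrix.mul_one]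
  calc _ = 1 + K * (M⁻¹ - N⁻¹ - N⁻¹ * (B * K) * M⁻¹) * B := by
        simp only [Matrix.mul_sub, Matrix.sub_mul, Matrix.mul_add, Matrix.mul_assoc,
          Matrix.one_mul, Matrix.mul_one]
        abel
    _ = 1 := by rw [h]; simp

theorem inv_mul_mul_feedback {M N : Matrix (Fin n) (Fin n) ℂ}
    {B : Matrix (Fin n) (Fin m) ℂ} {K : Matrix (Fin m) (Fin n) ℂ} (hM : IsUnit M.det)
    (hN : IsUnit N.det) (hMN : N = M + B * K) :
    M⁻¹ * B * (1 - K * N⁻¹ * B) = N⁻¹ * B := by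
  have h : M⁻¹ - M⁻¹ * (B * K) * N⁻¹ = N⁻¹ := by
    rw [← sub_eq_iff_eq_add'.2 hMN, Matrix.mul_sub, Matrix.sub_mul, Matrix.nonsing_inv_mul _ hM,
      Matrix.mul_assoc, Matrix.mul_nonsing_inv _ hN, Matrix.one_mul, Matrix.mul_one,
      sub_sub_cancel]
  calc _ = (M⁻¹ - M⁻¹ * (B * K) * N⁻¹) * B := by
        simp only [Matrix.mul_sub, Matrix.sub_mul, Matrix.mul_assoc, Matrix.mul_one]
    _ = _ := by rw [h]

theorem Matrix.mulVec_injective_of_rank_eq {B : Matrix (Fin n) (Fin m) ℂ} (hB : B.rank = m) :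
    Function.Injective B.mulVec := by
  rw [Matrix.mulVec_injective_iff, linearIndependent_iff_card_eq_finrank_span, Fintype.card_fin]
  rw [Matrix.rank_eq_finrank_span_cols] at hB
  exact hB.symm

end Feedback

section MatrixBounds

variable {m : ℕ}

theorem Matrix.PosSemidef.norm_apply_le {M : Matrix (Fin m) (Fin m) ℂ} {C : ℝ}
    (hM : M.PosSemidef) (hC : ((C : ℂ) • (1 : Matrix (Fin m) (Fin m) ℂ) - M).PosSemidef)
    (i j : Fin m) : ‖M i j‖ ≤ C := by
  have hd : ∀ i, 0 ≤ (M i i).re ∧ (M i i).re ≤ C ∧ (M i i).im = 0 := fun i => by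
    have h1 := Complex.nonneg_iff.1 (hM.diag_nonneg (i := i))
    have h2 := Complex.nonneg_iff.1 (hC.diag_nonneg (i := i))
    simp at h2
    exact ⟨h1.1, h2.1, h1.2.symm⟩
  have hdet := (hM.submatrix ![i, j]).det_nonneg
  have hji : M j i = star (M i j) := (hM.isHermitian.apply j i).symm
  rw [Matrix.det_fin_two] at hdet
  simp only [Matrix.submatrix_apply, Matrix.cons_val_zero, Matrix.cons_val_one, hji] at hdet
  have hre := (Complex.nonneg_iff.1 hdet).1
  have hn : (M i j * star (M i j)).re = ‖M i j‖ ^ 2 := by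
    rw [← Complex.ofReal_re (‖M i j‖ ^ 2), Complex.ofReal_pow]
    exact congrArg Complex.re (Complex.mul_conj' _)
  rw [Complex.sub_re, hn, Complex.mul_re, (hd i).2.2, zero_mul, sub_zero] at hre
  refine abs_le_of_sq_le_sq' ?_ ((hd i).1.trans (hd i).2.1) |>.2
  nlinarith [hd i, hd j]

theorem Matrix.star_dotProduct_self_eq (x : Fin m → ℂ) :
    star x ⬝ᵥ x = ((∑ i, ‖x i‖ ^ 2 : ℝ) : ℂ) := by
  simp only [dotProduct, Pi.star_apply, Complex.ofReal_sum, Complex.ofReal_pow]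
  exact Finset.sum_congr rfl fun i _ => Complex.conj_mul' _

theorem isCompact_sum_norm_sq_eq_one : IsCompact {x : Fin m → ℂ | ∑ i, ‖x i‖ ^ 2 = 1} := by
  refine Metric.isCompact_of_isClosed_isBounded
    (isClosed_eq (by fun_prop) continuous_const) ?_
  refine (Metric.isBounded_closedBall (x := (0 : Fin m → ℂ)) (r := 1)).subset fun x hx => ?_
  rw [mem_closedBall_zero_iff, pi_norm_le_iff_of_nonneg zero_le_one]
  intro i
  have : ‖x i‖ ^ 2 ≤ 1 :=
    (Finset.single_le_sum (f := fun i => ‖x i‖ ^ 2) (fun _ _ => by positivity)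
      (Finset.mem_univ i)).trans_eq hx
  exact (sq_le_one_iff₀ (norm_nonneg _)).1 this

theorem Matrix.re_form_eq_mul_normalized (M : Matrix (Fin m) (Fin m) ℂ) {x : Fin m → ℂ}
    (hx : x ≠ 0) : ∃ y : Fin m → ℂ, ∑ i, ‖y i‖ ^ 2 = 1 ∧
      (star x ⬝ᵥ (M *ᵥ x)).re = (∑ i, ‖x i‖ ^ 2) * (star y ⬝ᵥ (M *ᵥ y)).re := by
  have hs : 0 < ∑ i, ‖x i‖ ^ 2 := by
    obtain ⟨i, hi⟩ := Function.ne_iff.1 hx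
    exact Finset.sum_pos' (fun _ _ => by positivity)
      ⟨i, Finset.mem_univ i, pow_pos (norm_pos_iff.2 hi) 2⟩
  set s := ∑ i, ‖x i‖ ^ 2
  have hsq : √s ^ 2 = s := Real.sq_sqrt hs.le
  have hs0 : √s ≠ 0 := (Real.sqrt_pos.2 hs).ne'
  refine ⟨((√s)⁻¹ : ℝ) • x, ?_, ?_⟩
  · simp only [Pi.smul_apply, norm_smul, mul_pow, ← Finset.mul_sum, Real.norm_eq_abs, sq_abs,
      inv_pow, hsq]
    exact inv_mul_cancel₀ hs.ne'
  · rw [star_smul, Matrix.mulVec_smul, smul_dotProduct, dotProduct_smul, Complex.smul_re,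
      Complex.smul_re, star_trivial (√s)⁻¹, smul_eq_mul, smul_eq_mul, ← mul_assoc, ← mul_assoc]
    rw [show s * (√s)⁻¹ * (√s)⁻¹ = 1 by nth_rw 1 [← hsq]; field_simp, one_mul]

/-- A continuous periodic positive definite function is bounded and coercive. -/
theorem exists_bounds_of_continuous_periodic_posDef {Φ : ℝ → Matrix (Fin m) (Fin m) ℂ} {T : ℝ}
    (hT : 0 < T) (hc : Continuous Φ) (hp : Function.Periodic Φ T) (hpos : ∀ θ, (Φ θ).PosDef) :
    (∃ C : ℝ, ∀ θ : ℝ, ((C : ℂ) • (1 : Matrix (Fin m) (Fin m) ℂ) - Φ θ).PosSemidef) ∧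
      ∃ c : ℝ, 0 < c ∧
        ∀ θ : ℝ, (Φ θ - (c : ℂ) • (1 : Matrix (Fin m) (Fin m) ℂ)).PosSemidef := by
  let f : ℝ × (Fin m → ℂ) → ℝ := fun p => (star p.2 ⬝ᵥ (Φ p.1 *ᵥ p.2)).re
  have hf : Continuous f := Complex.continuous_re.comp
    ((continuous_star.comp continuous_snd).dotProduct
      ((hc.comp continuous_fst).matrix_mulVec continuous_snd))
  have hK : IsCompact (Set.Icc 0 T ×ˢ {x : Fin m → ℂ | ∑ i, ‖x i‖ ^ 2 = 1}) :=
    isCompact_Icc.prod isCompact_sum_norm_sq_eq_one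
  have hmem : ∀ θ, ∃ θ' ∈ Set.Icc 0 T, Φ θ = Φ θ' := fun θ =>
    (hp.exists_mem_Ico₀ hT θ).imp fun _ h => ⟨Set.Ico_subset_Icc_self h.1, h.2⟩
  have hform : ∀ θ x, star x ⬝ᵥ (Φ θ *ᵥ x) = ((star x ⬝ᵥ (Φ θ *ᵥ x)).re : ℂ) := fun θ x =>
    Complex.ext rfl (Complex.nonneg_iff.1
      ((hpos θ).posSemidef.dotProduct_mulVec_nonneg x)).2.symm
  have hherm : ∀ c : ℝ, ((c : ℂ) • (1 : Matrix (Fin m) (Fin m) ℂ)).IsHermitian := fun c => by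
    simp [Matrix.IsHermitian]
  obtain ⟨C, hC⟩ := hK.bddAbove_image hf.continuousOn
  obtain ⟨c, hc0, hc1⟩ := hK.exists_forall_le' (a := 0) hf.continuousOn fun p hp => by
    refine (Complex.pos_iff.1 ((hpos p.1).dotProduct_mulVec_pos ?_)).1
    intro h0
    have := hp.2
    simp [h0] at this
  refine ⟨⟨C, fun θ => ?_⟩, c, hc0, fun θ => ?_⟩ <;>
    obtain ⟨θ', hθ', he⟩ := hmem θ <;> rw [he]
  · refine .of_dotProduct_mulVec_nonneg ((hherm C).sub (hpos θ').1) fun x => ?_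
    rcases eq_or_ne x 0 with rfl | hx
    · simp
    obtain ⟨y, hy, hxy⟩ := Matrix.re_form_eq_mul_normalized (Φ θ') hx
    have hle : f (θ', y) ≤ C := hC ⟨(θ', y), ⟨hθ', hy⟩, rfl⟩
    rw [Matrix.sub_mulVec, Matrix.smul_mulVec, Matrix.one_mulVec, dotProduct_sub,
      dotProduct_smul, hform, hxy, Matrix.star_dotProduct_self_eq, smul_eq_mul,
      ← Complex.ofReal_mul, ← Complex.ofReal_sub, Complex.zero_le_real, sub_nonneg, mul_comm C]
    exact mul_le_mul_of_nonneg_left hle (by positivity)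
  · refine .of_dotProduct_mulVec_nonneg ((hpos θ').1.sub (hherm c)) fun x => ?_
    rcases eq_or_ne x 0 with rfl | hx
    · simp
    obtain ⟨y, hy, hxy⟩ := Matrix.re_form_eq_mul_normalized (Φ θ') hx
    have hle : c ≤ f (θ', y) := hc1 (θ', y) ⟨hθ', hy⟩
    rw [Matrix.sub_mulVec, Matrix.smul_mulVec, Matrix.one_mulVec, dotProduct_sub,
      dotProduct_smul, hform, hxy, Matrix.star_dotProduct_self_eq, smul_eq_mul,
      ← Complex.ofReal_mul, ← Complex.ofReal_sub, Complex.zero_le_real, sub_nonneg, mul_comm c]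
    exact mul_le_mul_of_nonneg_left hle (by positivity)

end MatrixBounds

section Covariance

variable {n m : ℕ} {A : Matrix (Fin n) (Fin n) ℂ} {B : Matrix (Fin n) (Fin m) ℂ}

theorem continuous_Gfun (hA : ∀ z ∈ spectrum ℂ A, ‖z‖ < 1) : Continuous (Gfun A B) :=
  (continuous_resolvent hA).matrix_mul continuous_const

/-- Every covariance produced by an integrable Hermitian density is in the range of the
Lyapunov-type map. -/
theorem exists_range_condition (hA : ∀ z ∈ spectrum ℂ A, ‖z‖ < 1)
    {Φ : ℝ → Matrix (Fin m) (Fin m) ℂ} (hΦ : CircleIntegrableM Φ) (hh : ∀ θ, (Φ θ).IsHermitian)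
    {S : Matrix (Fin n) (Fin n) ℂ}
    (hS : circleIntM (fun θ => Gfun A B θ * Φ θ * (Gfun A B θ)ᴴ) = S) :
    ∃ H : Matrix (Fin m) (Fin n) ℂ, S - A * S * Aᴴ = B * H + Hᴴ * Bᴴ := by
  have hG := continuous_Gfun (B := B) hA
  have hGΦ : CircleIntegrableM fun θ => Gfun A B θ * Φ θ := hΦ.continuous_mul hG
  have hGΦG : CircleIntegrableM fun θ => Gfun A B θ * Φ θ * (Gfun A B θ)ᴴ :=
    hGΦ.mul_continuous hG.matrix_conjTranspose
  have key : ∀ θ, Gfun A B θ * Φ θ * (Gfun A B θ)ᴴ =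
      A * (Gfun A B θ * Φ θ * (Gfun A B θ)ᴴ * Aᴴ) +
        (A * (Gfun A B θ * Φ θ * Bᴴ) + (B * ((Gfun A B θ * Φ θ)ᴴ * Aᴴ) + B * (Φ θ * Bᴴ))) := by
    intro θ
    have hu := isUnit_smul_one_sub hA (norm_exp_mul_I θ)
    have hz : Complex.exp (θ * Complex.I) * star (Complex.exp (θ * Complex.I)) = 1 := by
      have := Complex.mul_conj' (Complex.exp (θ * Complex.I))
      rwa [norm_exp_mul_I, Complex.ofReal_one, one_pow] at this
    have hzG : Complex.exp (θ * Complex.I) • Gfun A B θ = A * Gfun A B θ + B := by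
      have : (Complex.exp (θ * Complex.I) • 1 - A) * Gfun A B θ = B := by
        rw [Gfun, ← Matrix.mul_assoc, Matrix.mul_nonsing_inv _ hu, Matrix.one_mul]
      rw [Matrix.sub_mul, Matrix.smul_mul, Matrix.one_mul, sub_eq_iff_eq_add'] at this
      exact this
    have h1 : Gfun A B θ * Φ θ * (Gfun A B θ)ᴴ = Complex.exp (θ * Complex.I) • Gfun A B θ * Φ θ *
        (Complex.exp (θ * Complex.I) • Gfun A B θ)ᴴ := by
      rw [Matrix.conjTranspose_smul, Matrix.smul_mul, Matrix.smul_mul, Matrix.mul_smul, smul_smul,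
        hz, one_smul]
    conv_lhs => rw [h1, hzG]
    simp only [Matrix.conjTranspose_add, Matrix.conjTranspose_mul, (hh θ).eq, Matrix.add_mul,
      Matrix.mul_add, Matrix.mul_assoc]
    abel
  set P := circleIntM fun θ => Gfun A B θ * Φ θ
  set Q := circleIntM Φ
  have hQ : Qᴴ = Q := by
    rw [← circleIntM_conjTranspose]
    simp only [fun θ => (hh θ).eq, Q]
  have hSt : S = A * (S * Aᴴ) + (A * (P * Bᴴ) + (B * (Pᴴ * Aᴴ) + B * (Q * Bᴴ))) := by
    have i1 : CircleIntegrableM fun θ => Gfun A B θ * Φ θ * (Gfun A B θ)ᴴ * Aᴴ :=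
      hGΦG.mul_continuous continuous_const
    have i2 : CircleIntegrableM fun θ => Gfun A B θ * Φ θ * Bᴴ :=
      hGΦ.mul_continuous continuous_const
    have i3 : CircleIntegrableM fun θ => (Gfun A B θ * Φ θ)ᴴ * Aᴴ :=
      hGΦ.conjTranspose.mul_continuous continuous_const
    have i4 : CircleIntegrableM fun θ => Φ θ * Bᴴ := hΦ.mul_continuous continuous_const
    have j1 := i1.continuous_mul (continuous_const (y := A))
    have j2 := i2.continuous_mul (continuous_const (y := A))
    have j3 := i3.continuous_mul (continuous_const (y := B))
    have j4 := i4.continuous_mul (continuous_const (y := B))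
    calc S = _ := hS.symm
      _ = circleIntM (fun θ => A * (Gfun A B θ * Φ θ * (Gfun A B θ)ᴴ * Aᴴ) +
          (A * (Gfun A B θ * Φ θ * Bᴴ) +
            (B * ((Gfun A B θ * Φ θ)ᴴ * Aᴴ) + B * (Φ θ * Bᴴ)))) :=
          congrArg circleIntM (funext key)
      _ = _ := by
          rw [circleIntM_add j1 (j2.add (j3.add j4)), circleIntM_add j2 (j3.add j4),
            circleIntM_add j3 j4, circleIntM_const_mul _ i1, circleIntM_const_mul _ i2,
            circleIntM_const_mul _ i3, circleIntM_const_mul _ i4, circleIntM_mul_const _ hGΦG,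
            circleIntM_mul_const _ hGΦ, circleIntM_mul_const _ hGΦ.conjTranspose,
            circleIntM_mul_const _ hΦ, circleIntM_conjTranspose, hS]
  refine ⟨Pᴴ * Aᴴ + (2⁻¹ : ℂ) • (Q * Bᴴ), ?_⟩
  have hhalf : ∀ X : Matrix (Fin n) (Fin n) ℂ, (2⁻¹ : ℂ) • X + (2⁻¹ : ℂ) • X = X := fun X => by
    rw [← add_smul]; norm_num
  have h2 : star (2⁻¹ : ℂ) = 2⁻¹ := by simp
  calc S - A * S * Aᴴ = A * (P * Bᴴ) + (B * (Pᴴ * Aᴴ) + B * (Q * Bᴴ)) := by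
        rw [Matrix.mul_assoc, sub_eq_iff_eq_add']; exact hSt
    _ = A * (P * Bᴴ) + (B * (Pᴴ * Aᴴ) +
        ((2⁻¹ : ℂ) • (B * (Q * Bᴴ)) + (2⁻¹ : ℂ) • (B * (Q * Bᴴ)))) := by rw [hhalf]
    _ = _ := by
        simp only [Matrix.conjTranspose_add, Matrix.conjTranspose_mul, Matrix.conjTranspose_smul,
          Matrix.conjTranspose_conjTranspose, hQ, h2, Matrix.add_mul, Matrix.mul_add,
          Matrix.mul_smul, Matrix.smul_mul, Matrix.mul_assoc]
        abel

/-- The maximum entropy density realizes every positive definite matrix that satisfies the range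
condition. -/
theorem exists_continuous_density (hA : ∀ z ∈ spectrum ℂ A, ‖z‖ < 1) (hB : B.rank = m)
    {S : Matrix (Fin n) (Fin n) ℂ} (hS : S.PosDef) {H : Matrix (Fin m) (Fin n) ℂ}
    (hH : S - A * S * Aᴴ = B * H + Hᴴ * Bᴴ) :
    ∃ Φ : ℝ → Matrix (Fin m) (Fin m) ℂ,
      Continuous Φ ∧ Function.Periodic Φ (2 * Real.pi) ∧ (∀ θ : ℝ, (Φ θ).PosDef) ∧
      circleIntM (fun θ => Gfun A B θ * Φ θ * (Gfun A B θ)ᴴ) = S := by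
  have hΩ : (Bᴴ * S⁻¹ * B).PosDef :=
    hS.inv.conjTranspose_mul_mul_same (Matrix.mulVec_injective_of_rank_eq hB)
  set W := (Bᴴ * S⁻¹ * B)⁻¹ with hWdef
  have hW : W.PosDef := hΩ.inv
  have hWB : W * (Bᴴ * S⁻¹ * B) = 1 :=
    Matrix.nonsing_inv_mul _ ((Matrix.isUnit_iff_isUnit_det _).1 hΩ.isUnit)
  set K := W * Bᴴ * S⁻¹ * A with hK
  set F := A - B * K with hF
  have hStein : S - F * S * Fᴴ = B * W * Bᴴ :=
    stein_of_range_condition hS.1 ((Matrix.isUnit_iff_isUnit_det _).1 hS.isUnit) hW.1 hWB hH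
  have hFs := spectrum_feedback_lt_one hA hF hS hW hStein
  set R : ℝ → Matrix (Fin n) (Fin n) ℂ := fun θ =>
    (Complex.exp (θ * Complex.I) • (1 : Matrix (Fin n) (Fin n) ℂ) - F)⁻¹ with hR
  have hRc : Continuous R := continuous_resolvent hFs
  have hRp : Function.Periodic R (2 * Real.pi) := fun θ => by
    simp only [hR]
    congr 3
    push_cast
    rw [add_mul]
    exact Complex.exp_periodic _
  have hMN : ∀ θ : ℝ, Complex.exp (θ * Complex.I) • (1 : Matrix (Fin n) (Fin n) ℂ) - F =
      Complex.exp (θ * Complex.I) • (1 : Matrix (Fin n) (Fin n) ℂ) - A + B * K := fun θ => by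
    rw [hF]; abel
  set D : ℝ → Matrix (Fin m) (Fin m) ℂ := fun θ => 1 - K * R θ * B with hD
  have hDc : Continuous D := continuous_const.sub
    ((continuous_const.matrix_mul hRc).matrix_mul continuous_const)
  refine ⟨fun θ => D θ * W * (D θ)ᴴ,
    (hDc.matrix_mul continuous_const).matrix_mul hDc.matrix_conjTranspose, ?_, ?_, ?_⟩
  · intro θ
    simp only [hD, hRp θ]
  · intro θ
    refine hW.mul_mul_conjTranspose_same ?_
    have h := feedback_mul_return_difference (isUnit_smul_one_sub hA (norm_exp_mul_I θ))
      (isUnit_smul_one_sub hFs (norm_exp_mul_I θ)) (hMN θ)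
    intro v w hvw
    have := congrArg (fun u => u ᵥ* (1 + K *
      (Complex.exp (θ * Complex.I) • (1 : Matrix (Fin n) (Fin n) ℂ) - A)⁻¹ * B)) hvw
    simpa only [Matrix.vecMul_vecMul, hD, hR, h, Matrix.vecMul_one] using this
  · rw [← circleIntM_resolvent_mul_mul hFs hS.1, hStein]
    refine congrArg circleIntM (funext fun θ => ?_)
    have h : Gfun A B θ * D θ = R θ * B :=
      inv_mul_mul_feedback (isUnit_smul_one_sub hA (norm_exp_mul_I θ))
        (isUnit_smul_one_sub hFs (norm_exp_mul_I θ)) (hMN θ)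
    calc _ = (Gfun A B θ * D θ) * W * (Gfun A B θ * D θ)ᴴ := by
          simp only [Matrix.conjTranspose_mul, Matrix.mul_assoc]
      _ = _ := by
          rw [h]
          simp only [Matrix.conjTranspose_mul, Matrix.mul_assoc, hR]

theorem circleIntegrableM_of_bounded {Φ : ℝ → Matrix (Fin m) (Fin m) ℂ} {C : ℝ}
    (hm : ∀ i j, Measurable fun θ => Φ θ i j) (hC : ∀ θ i j, ‖Φ θ i j‖ ≤ C) :
    CircleIntegrableM Φ := fun i j =>
  (intervalIntegrable_const (c := C)).mono_fun (hm i j).aestronglyMeasurable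
    (.of_forall fun θ => (hC θ i j).trans (le_abs_self C))

end Covariance

theorem stmt0 {n m : ℕ} (A : Matrix (Fin n) (Fin n) ℂ) (B : Matrix (Fin n) (Fin m) ℂ)
    (hA : ∀ z ∈ spectrum ℂ A, ‖z‖ < 1) (hB : B.rank = m) (hAB : IsReachable A B)
    (Sg : Matrix (Fin n) (Fin n) ℂ) (hSg : Sg.PosDef) :
    List.TFAE
      [(∃ H : Matrix (Fin m) (Fin n) ℂ, Sg - A * Sg * Aᴴ = B * H + Hᴴ * Bᴴ),
       (∃ Φ : ℝ → Matrix (Fin m) (Fin m) ℂ,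
          (∀ i j, Measurable fun θ => Φ θ i j) ∧
          Function.Periodic Φ (2 * Real.pi) ∧
          (∃ C : ℝ, ∀ θ : ℝ, ((C : ℂ) • (1 : Matrix (Fin m) (Fin m) ℂ) - Φ θ).PosSemidef) ∧
          (∃ c : ℝ, 0 < c ∧
            ∀ θ : ℝ, (Φ θ - (c : ℂ) • (1 : Matrix (Fin m) (Fin m) ℂ)).PosSemidef) ∧
          (∀ θ : ℝ, (Φ θ).PosDef) ∧
          circleIntM (fun θ => Gfun A B θ * Φ θ * (Gfun A B θ)ᴴ) = Sg),
       (∃ Φ : ℝ → Matrix (Fin m) (Fin m) ℂ,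
          Continuous Φ ∧ Function.Periodic Φ (2 * Real.pi) ∧
          (∀ θ : ℝ, (Φ θ).PosDef) ∧
          circleIntM (fun θ => Gfun A B θ * Φ θ * (Gfun A B θ)ᴴ) = Sg)] := by
  tfae_have 1 → 3 := fun ⟨_, hH⟩ => exists_continuous_density hA hB hSg hH
  tfae_have 3 → 2 := fun ⟨Φ, hc, hp, hpos, hΦ⟩ =>
    have h := exists_bounds_of_continuous_periodic_posDef Real.two_pi_pos hc hp hpos
    ⟨Φ, fun i j => (hc.matrix_elem i j).measurable, hp, h.1, h.2, hpos, hΦ⟩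
  tfae_have 2 → 1 := fun ⟨_, hm, _, ⟨_, hC⟩, _, hpos, hΦ⟩ =>
    exists_range_condition hA
      (circleIntegrableM_of_bounded hm fun θ => (hpos θ).posSemidef.norm_apply_le (hC θ))
      (fun θ => (hpos θ).1) hΦ
  tfae_finish
end

section
/- Let A ∈ ℂ^{n×n} have spectral radius < 1 and B ∈ ℂ^{n×m} be such that the pair (A,B) is reachable (i.e., the block matrix [B, AB, ..., A^{n−1}B] has rank n). If the Hermitian matrix Σ₁ satisfies the discrete-time Lyapunov equation Σ₁ − AΣ₁A* = 2BB*, then Σ₁ is positive definite. -/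
open Matrix
open scoped ComplexOrder

open Filter Topology in
theorem tendsto_pow_zero_of_spectrum_norm_lt_one {R : Type*} [NormedRing R] [NormedAlgebra ℂ R]
    [CompleteSpace R] (a : R) (ha : ∀ z ∈ spectrum ℂ a, ‖z‖ < 1) :
    Tendsto (fun k : ℕ => a ^ k) atTop (𝓝 0) := by
  cases subsingleton_or_nontrivial R
  · exact tendsto_const_nhds.congr fun k => Subsingleton.elim 0 (a ^ k)
  have hr : spectralRadius ℂ a < (1 : NNReal) :=
    spectrum.spectralRadius_lt_of_forall_lt a fun z hz => by exact_mod_cast ha z hz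
  obtain ⟨r, har, hr1⟩ := ENNReal.lt_iff_exists_nnreal_btwn.mp hr
  have hr1 : (r : ℝ) < 1 := by exact_mod_cast hr1
  refine squeeze_zero_norm' ?_ (tendsto_pow_atTop_nhds_zero_of_lt_one r.coe_nonneg hr1)
  filter_upwards [(spectrum.pow_nnnorm_pow_one_div_tendsto_nhds_spectralRadius a).eventually_lt_const
    har, eventually_gt_atTop 0] with k hk hk0
  have hk0' : (0 : ℝ) < k := by exact_mod_cast hk0
  rw [one_div, ENNReal.rpow_inv_lt_iff hk0', ENNReal.rpow_natCast] at hk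
  exact_mod_cast hk.le

namespace Matrix

variable {ι : Type*} [Fintype ι]

theorem vecMul_injective_of_rank_eq_card {κ K : Type*} [Fintype κ] [Field K] {M : Matrix ι κ K}
    (hM : M.rank = Fintype.card ι) : Function.Injective M.vecMul := by
  rw [vecMul_injective_iff, linearIndependent_iff_card_eq_finrank_span, ← hM,
    rank_eq_finrank_span_row, Set.finrank]

variable [DecidableEq ι]

theorem sub_pow_mul_mul_conjTranspose_pow {R : Type*} [Ring R] [StarRing R] (A S : Matrix ι ι R)
    (k : ℕ) :
    S - A ^ k * S * (A ^ k)ᴴ =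
      ∑ i ∈ Finset.range k, A ^ i * (S - A * S * Aᴴ) * (A ^ i)ᴴ := by
  induction k with
  | zero => simp
  | succ k ih =>
    rw [Finset.sum_range_succ, ← ih, pow_succ, conjTranspose_mul]
    noncomm_ring

open Filter Topology in
theorem posSemidef_of_lyapunov {A S : Matrix ι ι ℂ}
    (hA : ∀ z ∈ spectrum ℂ A, ‖z‖ < 1) (hS : S.IsHermitian)
    (hQ : (S - A * S * Aᴴ).PosSemidef) : S.PosSemidef := by
  have hpow : Tendsto (fun k : ℕ => A ^ k) atTop (𝓝 0) := by
    open scoped Matrix.Norms.Operator in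
    exact tendsto_pow_zero_of_spectrum_norm_lt_one A hA
  refine .of_dotProduct_mulVec_nonneg hS fun x => ?_
  have hcont : Continuous fun M : Matrix ι ι ℂ => star x ⬝ᵥ ((S - M * S * Mᴴ) *ᵥ x) := by
    fun_prop
  have hlim := (hcont.tendsto 0).comp hpow
  simp only [zero_mul, sub_zero] at hlim
  refine ge_of_tendsto' hlim fun k => ?_
  simp only [Function.comp_apply, sub_pow_mul_mul_conjTranspose_pow]
  exact (posSemidef_sum _ fun i _ => hQ.mul_mul_conjTranspose_same (A ^ i)).dotProduct_mulVec_nonneg x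

end Matrix

theorem IsReachable.posDef_sum {n m : ℕ} {A : Matrix (Fin n) (Fin n) ℂ}
    {B : Matrix (Fin n) (Fin m) ℂ} (h : IsReachable A B) :
    (∑ k ∈ Finset.range n, A ^ k * (B * Bᴴ) * (A ^ k)ᴴ).PosDef := by
  have hsum : ∑ k ∈ Finset.range n, A ^ k * (B * Bᴴ) * (A ^ k)ᴴ =
      (of fun (i : Fin n) (p : Fin n × Fin m) => (A ^ (p.1 : ℕ) * B) i p.2) *
        (of fun (i : Fin n) (p : Fin n × Fin m) => (A ^ (p.1 : ℕ) * B) i p.2)ᴴ := by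
    have hk (k : ℕ) : A ^ k * (B * Bᴴ) * (A ^ k)ᴴ = (A ^ k * B) * (A ^ k * B)ᴴ := by
      simp only [conjTranspose_mul, Matrix.mul_assoc]
    ext i j
    simp_rw [hk, Finset.sum_range, Matrix.sum_apply, mul_apply (M := A ^ _ * B),
      mul_apply (M := Matrix.of _), Fintype.sum_prod_type, conjTranspose_apply, of_apply]
  rw [hsum]
  exact PosDef.mul_conjTranspose_self _
    (vecMul_injective_of_rank_eq_card (h.trans (Fintype.card_fin n).symm))

theorem stmt3 {n m : ℕ} (A : Matrix (Fin n) (Fin n) ℂ) (B : Matrix (Fin n) (Fin m) ℂ)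
    (hA : ∀ z ∈ spectrum ℂ A, ‖z‖ < 1) (hAB : IsReachable A B)
    (Sg : Matrix (Fin n) (Fin n) ℂ) (hSg : Sg.IsHermitian)
    (hLyap : Sg - A * Sg * Aᴴ = (2 : ℂ) • (B * Bᴴ)) :
    Sg.PosDef := by
  have hQ : (Sg - A * Sg * Aᴴ).PosSemidef :=
    hLyap ▸ (posSemidef_self_mul_conjTranspose B).smul zero_le_two
  have hS := posSemidef_of_lyapunov hA hSg hQ
  have hsum := sub_pow_mul_mul_conjTranspose_pow A Sg n
  simp_rw [hLyap, Matrix.mul_smul, Matrix.smul_mul, ← Finset.smul_sum] at hsum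
  rw [sub_eq_iff_eq_add.mp hsum]
  exact (hAB.posDef_sum.smul zero_lt_two).add_posSemidef (hS.mul_mul_conjTranspose_same (A ^ n))
end

section
/- Let A ∈ ℂ^{n×n} have spectral radius < 1, let W(z) = C(zI−A)^{-1}B + D with C ∈ ℂ^{m×n}, B ∈ ℂ^{n×m}, D ∈ ℂ^{m×m}, and let Π be the (unique) solution of the Lyapunov equation Π = AΠA* + BB*. Then ∫_{-π}^{π} W(e^{jθ})W(e^{jθ})* dθ/2π = CΠC* + DD*. -/
open Matrix MeasureTheory

/-- A matrix whose spectrum lies in the open unit disc has `1 - w • A` invertible for `‖w‖ ≤ 1`. -/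
theorem isUnit_one_sub_smul_of_spectrum_norm_lt_one {n : ℕ} {A : Matrix (Fin n) (Fin n) ℂ}
    (hA : ∀ z ∈ spectrum ℂ A, ‖z‖ < 1) {w : ℂ} (hw : ‖w‖ ≤ 1) :
    IsUnit (1 - w • A) := by
  rcases eq_or_ne w 0 with rfl | h0
  · simp
  have hz : w⁻¹ ∉ spectrum ℂ A := fun h => by
    have h1 := hA _ h
    rw [norm_inv] at h1
    exact absurd h1 (not_lt.2 ((one_le_inv₀ (norm_pos_iff.2 h0)).2 hw))
  rw [spectrum.notMem_iff] at hz
  have := hz.smul (Units.mk0 w h0)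
  rwa [Units.smul_mk0, smul_sub, Algebra.algebraMap_eq_smul_one, smul_smul,
    mul_inv_cancel₀ h0, one_smul] at this

/-- A matrix whose spectrum lies in the open unit disc has `exp(iθ) - A` invertible. -/
theorem isUnit_exp_smul_one_sub_of_spectrum_norm_lt_one {n : ℕ} {A : Matrix (Fin n) (Fin n) ℂ}
    (hA : ∀ z ∈ spectrum ℂ A, ‖z‖ < 1) (θ : ℝ) :
    IsUnit (Complex.exp (θ * Complex.I) • (1 : Matrix (Fin n) (Fin n) ℂ) - A) := by
  rw [← Algebra.algebraMap_eq_smul_one, ← spectrum.notMem_iff]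
  intro h
  have := hA _ h
  simp [Complex.norm_exp_ofReal_mul_I] at this

section

attribute [local instance] Matrix.linftyOpNormedRing Matrix.linftyOpNormedAlgebra

/-- Linear functionals of `(1 - w • A)⁻¹` are holomorphic in `w` wherever `1 - w • A` is
invertible. -/
theorem differentiableAt_linearMap_inv_one_sub_smul {n : ℕ} {A : Matrix (Fin n) (Fin n) ℂ}
    (L : Matrix (Fin n) (Fin n) ℂ →ₗ[ℂ] ℂ) {w : ℂ} (hw : IsUnit (1 - w • A)) :
    DifferentiableAt ℂ (fun w : ℂ => L (1 - w • A)⁻¹) w := by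
  simp only [Matrix.nonsing_inv_eq_ringInverse]
  have h1 : DifferentiableAt ℂ (fun w : ℂ => 1 - w • A) w := by fun_prop
  have h2 : DifferentiableAt ℂ Ring.inverse (1 - w • A) :=
    differentiableAt_inverse hw
  exact (LinearMap.toContinuousLinearMap L).differentiableAt.fun_comp' w
    (DifferentiableAt.fun_comp' w h2 h1)

end

/-- With `w = exp(-iθ)`, one has `(exp(iθ) - A)⁻¹ = w • (1 - w • A)⁻¹`. -/
theorem inv_exp_smul_one_sub {n : ℕ} (A : Matrix (Fin n) (Fin n) ℂ) (θ : ℝ) :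
    (Complex.exp (θ * Complex.I) • (1 : Matrix (Fin n) (Fin n) ℂ) - A)⁻¹ =
      circleMap 0 1 (-θ) • (1 - circleMap 0 1 (-θ) • A)⁻¹ := by
  set w := circleMap 0 1 (-θ)
  have hw : w = (Complex.exp (θ * Complex.I))⁻¹ := by
    simp [w, circleMap, Complex.exp_neg]
  have hw0 : w ≠ 0 := by simp [hw]
  have key : Complex.exp (θ * Complex.I) • (1 : Matrix (Fin n) (Fin n) ℂ) - A =
      (Units.mk0 w hw0)⁻¹ • (1 - w • A) := by
    rw [smul_sub, Units.smul_def, Units.smul_def, Units.val_inv_eq_inv_val, Units.val_mk0,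
      smul_smul, inv_mul_cancel₀ hw0, one_smul, hw, inv_inv]
  by_cases h : IsUnit (1 - w • A).det
  · rw [key, Matrix.inv_smul' _ _ h]
    simp [Units.smul_def]
  · have h' : ¬ IsUnit ((Units.mk0 w hw0)⁻¹ • (1 - w • A)).det := by
      rw [← Matrix.isUnit_iff_isUnit_det] at h ⊢
      rwa [isUnit_smul_iff]
    rw [key, Matrix.nonsing_inv_apply_not_isUnit _ h, Matrix.nonsing_inv_apply_not_isUnit _ h',
      smul_zero]

/-- The resolvent of a stability matrix has zero mean over the unit circle. -/
theorem integral_linearMap_resolvent_eq_zero {n : ℕ} {A : Matrix (Fin n) (Fin n) ℂ}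
    (hA : ∀ z ∈ spectrum ℂ A, ‖z‖ < 1) (L : Matrix (Fin n) (Fin n) ℂ →ₗ[ℂ] ℂ) :
    ∫ θ in (-Real.pi)..Real.pi,
      L (Complex.exp (θ * Complex.I) • (1 : Matrix (Fin n) (Fin n) ℂ) - A)⁻¹ = 0 := by
  set f : ℂ → ℂ := fun w => w * L (1 - w • A)⁻¹ with hf
  have hd : DiffContOnCl ℂ f (Metric.ball 0 |1|) := by
    apply DifferentiableOn.diffContOnCl
    rw [closure_ball _ (by simp)]
    intro w hw
    refine (differentiableAt_id.mul (differentiableAt_linearMap_inv_one_sub_smul L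
      (isUnit_one_sub_smul_of_spectrum_norm_lt_one hA ?_))).differentiableWithinAt
    simpa using hw
  have h1 : ∫ θ in (0 : ℝ)..2 * Real.pi, f (circleMap 0 1 θ) = 0 := by
    have h := hd.circleAverage
    rw [Real.circleAverage_def] at h
    simpa [hf, Real.pi_ne_zero] using h
  have hper : Function.Periodic (fun θ => f (circleMap 0 1 θ)) (2 * Real.pi) :=
    fun θ => congrArg f (periodic_circleMap 0 1 θ)
  have h2 := hper.intervalIntegral_add_eq (-Real.pi) 0
  rw [zero_add, h1, show -Real.pi + 2 * Real.pi = Real.pi by ring] at h2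
  have h3 := intervalIntegral.integral_comp_neg (a := -Real.pi) (b := Real.pi)
    (fun θ => f (circleMap 0 1 θ))
  rw [neg_neg, h2] at h3
  rw [← h3]
  simp only [inv_exp_smul_one_sub, map_smul, smul_eq_mul, hf]

/-- Linear functionals of the resolvent of a stability matrix are continuous on the unit circle. -/
theorem continuous_linearMap_resolvent {n : ℕ} {A : Matrix (Fin n) (Fin n) ℂ}
    (hA : ∀ z ∈ spectrum ℂ A, ‖z‖ < 1) (L : Matrix (Fin n) (Fin n) ℂ →ₗ[ℂ] ℂ) :
    Continuous fun θ : ℝ =>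
      L (Complex.exp (θ * Complex.I) • (1 : Matrix (Fin n) (Fin n) ℂ) - A)⁻¹ := by
  simp only [inv_exp_smul_one_sub, map_smul, smul_eq_mul]
  have hc : Continuous fun θ : ℝ => circleMap 0 1 (-θ) := by fun_prop
  refine hc.mul (continuous_iff_continuousAt.2 fun θ => ?_)
  have hu : IsUnit (1 - circleMap 0 1 (-θ) • A) :=
    isUnit_one_sub_smul_of_spectrum_norm_lt_one hA (by simp)
  exact ContinuousAt.comp (f := fun θ : ℝ => circleMap 0 1 (-θ))
    (differentiableAt_linearMap_inv_one_sub_smul L hu).continuousAt hc.continuousAt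

/-- The entry `(i, j)` of `P * X * Q` as a linear functional of `X`. -/
def mulMulEntry {n m : ℕ} (P : Matrix (Fin m) (Fin n) ℂ) (Q : Matrix (Fin n) (Fin m) ℂ)
    (i j : Fin m) : Matrix (Fin n) (Fin n) ℂ →ₗ[ℂ] ℂ where
  toFun X := (P * X * Q) i j
  map_add' X Y := by simp [Matrix.mul_add, Matrix.add_mul]
  map_smul' c X := by simp

/-- If `Π = A Π A* + B B*` and `|z| = 1`, then with `R = (z - A)⁻¹` one has
`R B B* R* = Π + R A Π + Π A* R*`. -/
theorem inv_mul_mul_conjTranspose_inv_of_lyapunov {n m : ℕ} {A P : Matrix (Fin n) (Fin n) ℂ}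
    {B : Matrix (Fin n) (Fin m) ℂ} (hP : P = A * P * Aᴴ + B * Bᴴ) {z : ℂ}
    (hz : z * star z = 1) (hu : IsUnit (z • (1 : Matrix (Fin n) (Fin n) ℂ) - A)) :
    (z • 1 - A)⁻¹ * B * Bᴴ * ((z • 1 - A)⁻¹)ᴴ =
      P + (z • 1 - A)⁻¹ * A * P + P * Aᴴ * ((z • 1 - A)⁻¹)ᴴ := by
  set M := z • (1 : Matrix (Fin n) (Fin n) ℂ) - A with hM
  have hdet := (Matrix.isUnit_iff_isUnit_det _).1 hu
  have h1 : M⁻¹ * M = 1 := Matrix.nonsing_inv_mul _ hdet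
  have h2 : Mᴴ * (M⁻¹)ᴴ = 1 := by
    rw [← Matrix.conjTranspose_mul, h1, Matrix.conjTranspose_one]
  have key : B * Bᴴ = M * P * Mᴴ + A * P * Mᴴ + M * P * Aᴴ := by
    have hzP : (z • (1 : Matrix (Fin n) (Fin n) ℂ)) * P * (star z • 1) = P := by
      simp [smul_smul, mul_comm (starRingEnd ℂ z), show z * (starRingEnd ℂ) z = 1 from hz]
    have hB : B * Bᴴ = P - A * P * Aᴴ := by
      rw [eq_sub_iff_add_eq, add_comm]
      exact hP.symm
    have hMH : Mᴴ = star z • 1 - Aᴴ := by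
      simp [hM, Matrix.conjTranspose_sub, Matrix.conjTranspose_smul]
    rw [hB, hMH, hM]
    generalize z • (1 : Matrix (Fin n) (Fin n) ℂ) = Z at hzP ⊢
    generalize star z • (1 : Matrix (Fin n) (Fin n) ℂ) = Z' at hzP ⊢
    nth_rw 1 [← hzP]
    noncomm_ring
  calc M⁻¹ * B * Bᴴ * (M⁻¹)ᴴ = M⁻¹ * (B * Bᴴ) * (M⁻¹)ᴴ := by simp only [Matrix.mul_assoc]
    _ = (M⁻¹ * M) * P * (Mᴴ * (M⁻¹)ᴴ) + M⁻¹ * A * P * (Mᴴ * (M⁻¹)ᴴ)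
        + (M⁻¹ * M) * P * Aᴴ * (M⁻¹)ᴴ := by
      rw [key]
      noncomm_ring
    _ = _ := by simp only [h1, h2, Matrix.one_mul, Matrix.mul_one]

theorem stmt12 {n m : ℕ} (A : Matrix (Fin n) (Fin n) ℂ)
    (hA : ∀ z ∈ spectrum ℂ A, ‖z‖ < 1)
    (C : Matrix (Fin m) (Fin n) ℂ) (B : Matrix (Fin n) (Fin m) ℂ)
    (D : Matrix (Fin m) (Fin m) ℂ) (Pi' : Matrix (Fin n) (Fin n) ℂ)
    (hPi : Pi' = A * Pi' * Aᴴ + B * Bᴴ)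
    (W : ℝ → Matrix (Fin m) (Fin m) ℂ)
    (hW : ∀ θ : ℝ, W θ =
      C * (Complex.exp (θ * Complex.I) • (1 : Matrix (Fin n) (Fin n) ℂ) - A)⁻¹ * B + D) :
    circleIntM (fun θ => W θ * (W θ)ᴴ) = C * Pi' * Cᴴ + D * Dᴴ := by
  set R : ℝ → Matrix (Fin n) (Fin n) ℂ := fun θ =>
    (Complex.exp (θ * Complex.I) • (1 : Matrix (Fin n) (Fin n) ℂ) - A)⁻¹
  have hWW : ∀ θ, W θ * (W θ)ᴴ = (C * Pi' * Cᴴ + D * Dᴴ)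
      + C * R θ * (A * Pi' * Cᴴ + B * Dᴴ) + (C * R θ * (A * Pi'ᴴ * Cᴴ + B * Dᴴ))ᴴ := by
    intro θ
    have hlyap := inv_mul_mul_conjTranspose_inv_of_lyapunov hPi
      (z := Complex.exp (θ * Complex.I))
      (by
        rw [Complex.star_def, Complex.mul_conj, Complex.normSq_eq_norm_sq,
          Complex.norm_exp_ofReal_mul_I]
        simp) (isUnit_exp_smul_one_sub_of_spectrum_norm_lt_one hA θ)
    change R θ * B * Bᴴ * (R θ)ᴴ = Pi' + R θ * A * Pi' + Pi' * Aᴴ * (R θ)ᴴ at hlyap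
    have hexp : W θ * (W θ)ᴴ = C * (R θ * B * Bᴴ * (R θ)ᴴ) * Cᴴ + C * R θ * B * Dᴴ
        + D * Bᴴ * (R θ)ᴴ * Cᴴ + D * Dᴴ := by
      rw [hW θ]
      change (C * R θ * B + D) * (C * R θ * B + D)ᴴ = _
      simp only [Matrix.conjTranspose_add, Matrix.conjTranspose_mul, Matrix.mul_add,
        Matrix.add_mul, Matrix.mul_assoc]
      abel
    rw [hexp, hlyap]
    simp only [Matrix.conjTranspose_add, Matrix.conjTranspose_mul,
      Matrix.conjTranspose_conjTranspose, Matrix.mul_add, Matrix.add_mul, Matrix.mul_assoc]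
    abel
  ext i j
  set L₁ := mulMulEntry C (A * Pi' * Cᴴ + B * Dᴴ) i j
  set L₂ := mulMulEntry C (A * Pi'ᴴ * Cᴴ + B * Dᴴ) j i
  set c := (C * Pi' * Cᴴ + D * Dᴴ) i j
  have hentry : ∀ θ, (W θ * (W θ)ᴴ) i j = c + L₁ (R θ) + (starRingEnd ℂ) (L₂ (R θ)) := by
    intro θ
    rw [hWW θ]
    rfl
  have hi₁ : IntervalIntegrable (fun θ => L₁ (R θ)) volume (-Real.pi) Real.pi :=
    (continuous_linearMap_resolvent hA L₁).intervalIntegrable _ _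
  have hi₂ : IntervalIntegrable (fun θ => (starRingEnd ℂ) (L₂ (R θ))) volume
      (-Real.pi) Real.pi :=
    (Complex.continuous_conj.comp
      (continuous_linearMap_resolvent hA L₂)).intervalIntegrable _ _
  have hz₂ : ∫ θ in (-Real.pi)..Real.pi, (starRingEnd ℂ) (L₂ (R θ)) = 0 := by
    have h := integral_linearMap_resolvent_eq_zero hA L₂
    rw [intervalIntegral.integral_of_le (by linarith [Real.pi_pos])] at h ⊢
    rw [integral_conj, h, map_zero]
  have hint : ∫ θ in (-Real.pi)..Real.pi, (W θ * (W θ)ᴴ) i j = (2 * Real.pi : ℂ) * c := by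
    simp only [hentry]
    rw [intervalIntegral.integral_add (intervalIntegrable_const.add hi₁) hi₂,
      intervalIntegral.integral_add intervalIntegrable_const hi₁, hz₂,
      integral_linearMap_resolvent_eq_zero hA L₁, intervalIntegral.integral_const]
    simp only [add_zero, Complex.real_smul]
    push_cast
    ring
  have hpi : (2 * Real.pi : ℂ) ≠ 0 := by simp [Real.pi_ne_zero]
  simp only [circleIntM, Matrix.of_apply]
  rw [hint, inv_mul_cancel_left₀ hpi]
end
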